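/- Let d be a positive multiple of 8, let C be a doubly-even binary linear code of length d containing the all-ones vector, equipped with the standard marking {(1,2),(3,4),…,(d−1,d)}, and let Γ = Ĉ + Σ₂^{d/2} = {ĉ + s : c ∈ C, s ∈ Σ₂^{d/2}} be the associated ℤ₄-code. Then the symmetrized weight enumerator of Γ satisfies swe_Γ(A,B,C) = smwe_C(A² + C², 2B², 2AC), i.e. ∑_{γ ∈ Γ} A^{#{i : γ i = 0}} B^{#{i : γ i ∈ {1,3}}} C^{#{i : γ i = 2}} = ∑_{c ∈ C} (A²+C²)^{#{k : c(k)=(0,0)}} (2B²)^{#{k : c(k)∈{(1,0),(0,1)}}} (2AC)^{#{k : c(k)=(1,1)}}. -/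

import Mathlib

open scoped Classical

/-- The first coordinate `2k−1` of the `k`-th pair of the standard marking (0-indexed). -/
def q0 {n : ℕ} (k : Fin n) : Fin (2 * n) := ⟨2 * k.val, by have := k.isLt; omega⟩

/-- The second coordinate `2k` of the `k`-th pair of the standard marking (0-indexed). -/
def q1 {n : ℕ} (k : Fin n) : Fin (2 * n) := ⟨2 * k.val + 1, by have := k.isLt; omega⟩

/-- The hat map `(ZMod 2)² → (ZMod 4)²`:
`(0,0)↦(0,0)`, `(1,1)↦(2,0)`, `(1,0)↦(1,1)`, `(0,1)↦(3,1)`. -/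
def hatPair (a b : ZMod 2) : ZMod 4 × ZMod 4 :=
  if a = 0 then (if b = 0 then (0, 0) else (3, 1))
  else (if b = 0 then (1, 1) else (2, 0))

/-- The blockwise hat map `(ZMod 2)^d → (ZMod 4)^d`, `c ↦ ĉ` (`d = 2n`). -/
def hatMap {n : ℕ} (c : Fin (2 * n) → ZMod 2) (i : Fin (2 * n)) : ZMod 4 :=
  let k : Fin n := ⟨i.val / 2, by have := i.isLt; omega⟩
  if i.val % 2 = 0 then (hatPair (c (q0 k)) (c (q1 k))).1
  else (hatPair (c (q0 k)) (c (q1 k))).2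

/-- The ℤ₄-code `Σ₂^{d/2}`: all coordinate pairs equal to `(0,0)` or `(2,2)`. -/
def SigmaFull (n : ℕ) : Set (Fin (2 * n) → ZMod 4) :=
  {s | ∀ k : Fin n, (s (q0 k) = 0 ∧ s (q1 k) = 0) ∨ (s (q0 k) = 2 ∧ s (q1 k) = 2)}

/-- The ℤ₄-code `Γ = Ĉ + Σ₂^{d/2}` associated to a marked binary code `C`. -/
def GammaCode {n : ℕ} (C : Submodule (ZMod 2) (Fin (2 * n) → ZMod 2)) :
    Set (Fin (2 * n) → ZMod 4) :=
  {x | ∃ c ∈ C, ∃ s ∈ SigmaFull n, x = hatMap c + s}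

/-- The symmetrized weight enumerator of a ℤ₄-code, evaluated at `(A, B, C)`. -/
noncomputable def sweEval {d : ℕ} (Δ : Set (Fin d → ZMod 4)) (A B C : ℝ) : ℝ :=
  ∑ γ ∈ Δ.toFinset,
    A ^ (Finset.univ.filter fun i => γ i = 0).card *
    B ^ (Finset.univ.filter fun i => γ i = 1 ∨ γ i = 3).card *
    C ^ (Finset.univ.filter fun i => γ i = 2).card

/-- The symmetrized marked weight enumerator of a binary code with the standard
marking, evaluated at `(x, y, z)`. -/
noncomputable def smweEval {n : ℕ} (C : Submodule (ZMod 2) (Fin (2 * n) → ZMod 2))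
    (x y z : ℝ) : ℝ :=
  ∑ c : C,
    x ^ (Finset.univ.filter fun k : Fin n =>
        (c : Fin (2 * n) → ZMod 2) (q0 k) = 0 ∧ (c : Fin (2 * n) → ZMod 2) (q1 k) = 0).card *
    y ^ (Finset.univ.filter fun k : Fin n =>
        ((c : Fin (2 * n) → ZMod 2) (q0 k) = 1 ∧ (c : Fin (2 * n) → ZMod 2) (q1 k) = 0) ∨
        ((c : Fin (2 * n) → ZMod 2) (q0 k) = 0 ∧ (c : Fin (2 * n) → ZMod 2) (q1 k) = 1)).card *
    z ^ (Finset.univ.filter fun k : Fin n =>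
        (c : Fin (2 * n) → ZMod 2) (q0 k) = 1 ∧ (c : Fin (2 * n) → ZMod 2) (q1 k) = 1).card

/-- The Hamming weight of a binary vector. -/
def hamWt {m : ℕ} (c : Fin m → ZMod 2) : ℕ := (Finset.univ.filter fun i => c i ≠ 0).card

/-- The element of `Σ₂^{d/2}` whose `k`-th pair is `(2,2)` if `t k` is true and `(0,0)` otherwise. -/
def sigmaVec {n : ℕ} (t : Fin n → Bool) (i : Fin (2 * n)) : ZMod 4 :=
  if t ⟨i.val / 2, by have := i.isLt; omega⟩ then 2 else 0

section Pairs

variable {n : ℕ}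

/-- The standard marking as a bijection between `n` pairs and `2n` coordinates. -/
def markingEquiv (n : ℕ) : Fin n × Fin 2 ≃ Fin (2 * n) :=
  finProdFinEquiv.trans (finCongr (Nat.mul_comm n 2))

lemma markingEquiv_zero (k : Fin n) : markingEquiv n (k, 0) = q0 k := by
  ext; simp [markingEquiv, q0]

lemma markingEquiv_one (k : Fin n) : markingEquiv n (k, 1) = q1 k := by
  ext; simp [markingEquiv, q1, Nat.add_comm]

lemma prod_eq_prod_pairs {M : Type*} [CommMonoid M] (f : Fin (2 * n) → M) :
    ∏ i, f i = ∏ k : Fin n, f (q0 k) * f (q1 k) := by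
  rw [← (markingEquiv n).prod_comp, Fintype.prod_prod_type]
  simp [Fin.prod_univ_two, markingEquiv_zero, markingEquiv_one]

lemma funext_pairs {α : Type*} {f g : Fin (2 * n) → α}
    (h : ∀ k, f (q0 k) = g (q0 k) ∧ f (q1 k) = g (q1 k)) : f = g := by
  funext i
  obtain ⟨⟨k, j⟩, rfl⟩ := (markingEquiv n).surjective i
  fin_cases j
  · simpa [markingEquiv_zero] using (h k).1
  · simpa [markingEquiv_one] using (h k).2

lemma hatMap_q0 (c : Fin (2 * n) → ZMod 2) (k : Fin n) :
    hatMap c (q0 k) = (hatPair (c (q0 k)) (c (q1 k))).1 := by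
  simp [hatMap, q0]

lemma hatMap_q1 (c : Fin (2 * n) → ZMod 2) (k : Fin n) :
    hatMap c (q1 k) = (hatPair (c (q0 k)) (c (q1 k))).2 := by
  have h : (2 * k.val + 1) / 2 = k.val := by omega
  simp [hatMap, q0, q1, h]

lemma sigmaVec_q0 (t : Fin n → Bool) (k : Fin n) :
    sigmaVec t (q0 k) = if t k then 2 else 0 := by
  simp [sigmaVec, q0]

lemma sigmaVec_q1 (t : Fin n → Bool) (k : Fin n) :
    sigmaVec t (q1 k) = if t k then 2 else 0 := by
  have h : (2 * k.val + 1) / 2 = k.val := by omega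
  simp [sigmaVec, q1, h]

lemma range_sigmaVec : Set.range (sigmaVec (n := n)) = SigmaFull n := by
  have two_ne_zero : (2 : ZMod 4) ≠ 0 := by decide
  ext s
  constructor
  · rintro ⟨t, rfl⟩ k
    cases h : t k <;> simp [sigmaVec_q0, sigmaVec_q1, h]
  · intro hs
    refine ⟨fun k => decide (s (q0 k) = 2), funext_pairs fun k => ?_⟩
    rcases hs k with ⟨h₀, h₁⟩ | ⟨h₀, h₁⟩ <;>
      simp [sigmaVec_q0, sigmaVec_q1, h₀, h₁, two_ne_zero.symm]

end Pairs

lemma hatPair_add_injective : ∀ (a b a' b' : ZMod 2) (t t' : Bool),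
    (hatPair a b).1 + (if t then 2 else 0) = (hatPair a' b').1 + (if t' then 2 else 0) →
    (hatPair a b).2 + (if t then 2 else 0) = (hatPair a' b').2 + (if t' then 2 else 0) →
    a = a' ∧ b = b' ∧ t = t' := by
  decide

lemma hatMap_add_sigmaVec_injective {n : ℕ} :
    Function.Injective fun p : (Fin (2 * n) → ZMod 2) × (Fin n → Bool) =>
      hatMap p.1 + sigmaVec p.2 := by
  rintro ⟨c, t⟩ ⟨c', t'⟩ h
  have key (k : Fin n) : c (q0 k) = c' (q0 k) ∧ c (q1 k) = c' (q1 k) ∧ t k = t' k := by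
    have h₀ := congrFun h (q0 k)
    have h₁ := congrFun h (q1 k)
    simp only [Pi.add_apply, hatMap_q0, hatMap_q1, sigmaVec_q0, sigmaVec_q1] at h₀ h₁
    exact hatPair_add_injective _ _ _ _ _ _ h₀ h₁
  exact Prod.ext (funext_pairs fun k => ⟨(key k).1, (key k).2.1⟩) (funext fun k => (key k).2.2)

lemma sum_gammaCode {n : ℕ} {M : Type*} [AddCommMonoid M]
    (C : Submodule (ZMod 2) (Fin (2 * n) → ZMod 2)) (f : (Fin (2 * n) → ZMod 4) → M) :
    ∑ γ ∈ (GammaCode C).toFinset, f γ =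
      ∑ c : C, ∑ t : Fin n → Bool, f (hatMap (c : Fin (2 * n) → ZMod 2) + sigmaVec t) := by
  have himage : (GammaCode C).toFinset = Finset.univ.image fun p : C × (Fin n → Bool) =>
      hatMap (p.1 : Fin (2 * n) → ZMod 2) + sigmaVec p.2 := by
    ext x
    rw [Set.mem_toFinset]
    simp [GammaCode, ← range_sigmaVec, eq_comm]
  rw [himage, Finset.sum_image, Fintype.sum_prod_type]
  rintro ⟨c, t⟩ - ⟨c', t'⟩ - h
  have h' := @hatMap_add_sigmaVec_injective n (↑c, t) (↑c', t') h
  obtain ⟨hc, ht⟩ := Prod.mk.inj h'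
  exact Prod.ext (Subtype.ext hc) ht

/-- The product of three powers counting coordinates by type, as a product over coordinates. -/
lemma pow_card_mul_pow_card_mul_pow_card {ι M : Type*} [Fintype ι] [CommMonoid M]
    (p q r : ι → Prop) [DecidablePred p] [DecidablePred q] [DecidablePred r] (a b c : M) :
    a ^ (Finset.univ.filter p).card * b ^ (Finset.univ.filter q).card *
        c ^ (Finset.univ.filter r).card =
      ∏ i, (if p i then a else 1) * (if q i then b else 1) * (if r i then c else 1) := by
  simp only [Finset.prod_mul_distrib, ← Finset.prod_filter, Finset.prod_const]

/-- The factor contributed by one coordinate to the symmetrized weight enumerator. -/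
noncomputable def sweFactor (A B C : ℝ) (v : ZMod 4) : ℝ :=
  (if v = 0 then A else 1) * (if v = 1 ∨ v = 3 then B else 1) * (if v = 2 then C else 1)

lemma sum_sweFactor_hatPair (A B C : ℝ) (a b : ZMod 2) :
    ∑ t : Bool, sweFactor A B C ((hatPair a b).1 + if t then 2 else 0) *
        sweFactor A B C ((hatPair a b).2 + if t then 2 else 0) =
      (if a = 0 ∧ b = 0 then A ^ 2 + C ^ 2 else 1) *
        (if (a = 1 ∧ b = 0) ∨ (a = 0 ∧ b = 1) then 2 * B ^ 2 else 1) *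
        (if a = 1 ∧ b = 1 then 2 * A * C else 1) := by
  have f₀ : sweFactor A B C 0 = A := by
    simp [sweFactor, show ¬((0 : ZMod 4) = 1 ∨ (0 : ZMod 4) = 3) by decide,
      show (0 : ZMod 4) ≠ 2 by decide]
  have f₁ : sweFactor A B C 1 = B := by
    simp [sweFactor, show (1 : ZMod 4) ≠ 0 by decide, show (1 : ZMod 4) ≠ 2 by decide]
  have f₂ : sweFactor A B C 2 = C := by
    simp [sweFactor, show ¬((2 : ZMod 4) = 1 ∨ (2 : ZMod 4) = 3) by decide,
      show (2 : ZMod 4) ≠ 0 by decide]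
  have f₃ : sweFactor A B C 3 = B := by
    simp [sweFactor, show (3 : ZMod 4) ≠ 0 by decide, show (3 : ZMod 4) ≠ 2 by decide]
  have h₁ : (1 : ZMod 4) + 2 = 3 := by decide
  have h₂ : (2 : ZMod 4) + 2 = 0 := by decide
  have h₃ : (3 : ZMod 4) + 2 = 1 := by decide
  have hbit : ∀ x : ZMod 2, x = 0 ∨ x = 1 := by decide
  rcases hbit a with rfl | rfl <;> rcases hbit b with rfl | rfl <;>
    simp [hatPair, h₁, h₂, h₃, f₀, f₁, f₂, f₃] <;> ring

/-- For a doubly-even binary code `C` of length `d = 2n` (a positive multiple of 8)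
containing the all-ones vector, with the standard marking, the symmetrized weight
enumerator of `Γ = Ĉ + Σ₂^{d/2}` satisfies
`swe_Γ(A,B,C) = smwe_C(A² + C², 2B², 2AC)`. -/
theorem stmt_7 (n : ℕ) (hn : 0 < n) (h4 : 4 ∣ n)
    (C : Submodule (ZMod 2) (Fin (2 * n) → ZMod 2))
    (hde : ∀ c ∈ C, 4 ∣ hamWt c)
    (hone : (fun _ => 1 : Fin (2 * n) → ZMod 2) ∈ C) :
    ∀ A B Cv : ℝ,
      sweEval (GammaCode C) A B Cv =
        smweEval C (A ^ 2 + Cv ^ 2) (2 * B ^ 2) (2 * A * Cv) := by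
  intro A B Cv
  rw [sweEval, sum_gammaCode, smweEval]
  refine Finset.sum_congr rfl fun c _ => ?_
  simp only [pow_card_mul_pow_card_mul_pow_card, ← sum_sweFactor_hatPair]
  rw [Finset.prod_univ_sum, Fintype.piFinset_univ]
  refine Finset.sum_congr rfl fun t _ => ?_
  rw [prod_eq_prod_pairs]
  simp only [Pi.add_apply, hatMap_q0, hatMap_q1, sigmaVec_q0, sigmaVec_q1, sweFactor]
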